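/- Let F be a field of characteristic different from two, let p be an anisotropic form over F containing a subform r of dimension at least two, and let q be a form over F. Then the Witt index of q over the function field F(r) is at least the Witt index of q over the function field F(p), i.e. i(q_{F(r)}) ≥ i(q_{F(p)}). -/

import Mathlib

set_option synthInstance.maxHeartbeats 1000000
set_option maxHeartbeats 4000000

open scoped BigOperators Classical

namespace QF

section Defs

variable {R : Type*} [CommRing R]

/-- Evaluation of the diagonal quadratic form with coefficients `d` at the vector `v`. -/
def evalQF {n : ℕ} (d : Fin n → R) (v : Fin n → R) : R := ∑ i, d i * v i ^ 2

/-- A form is isotropic if it represents zero non-trivially. -/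
def Isotropic {n : ℕ} (d : Fin n → R) : Prop := ∃ v : Fin n → R, v ≠ 0 ∧ evalQF d v = 0

def Anisotropic {n : ℕ} (d : Fin n → R) : Prop := ¬ Isotropic d

/-- Nondegeneracy of a diagonal form: all coefficients are nonzero. -/
def Nondeg {n : ℕ} (d : Fin n → R) : Prop := ∀ i, d i ≠ 0

/-- Two diagonal forms are isometric if a linear equivalence matches their values. -/
def Isometric {m n : ℕ} (d : Fin m → R) (e : Fin n → R) : Prop :=
  ∃ φ : (Fin m → R) ≃ₗ[R] (Fin n → R), ∀ v, evalQF e (φ v) = evalQF d v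

/-- Orthogonal sum of diagonal forms. -/
def osum {m n : ℕ} (d : Fin m → R) (e : Fin n → R) : Fin (m + n) → R := Fin.append d e

/-- Tensor product of diagonal forms. -/
def tensorQF {m n : ℕ} (d : Fin m → R) (e : Fin n → R) : Fin (m * n) → R :=
  fun i => d (finProdFinEquiv.symm i).1 * e (finProdFinEquiv.symm i).2

/-- Scaling of a form by a scalar. -/
def smulQF {n : ℕ} (a : R) (d : Fin n → R) : Fin n → R := fun i => a * d i

/-- `k` copies of the hyperbolic plane `⟨1,-1⟩`. -/
def hypform {R : Type*} [CommRing R] (k : ℕ) : Fin (k + k) → R :=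
  Fin.append (fun _ => 1) (fun _ => -1)

/-- A form is hyperbolic if it is isometric to a sum of hyperbolic planes,
i.e. its Witt index is half its dimension. -/
def IsHyperbolic {n : ℕ} (d : Fin n → R) : Prop := ∃ k : ℕ, Isometric d (hypform k)

/-- The Witt index: the largest `k` such that `d ≅ k×⟨1,-1⟩ ⊥ r`. -/
noncomputable def WittIndex {n : ℕ} (d : Fin n → R) : ℕ :=
  sSup {k : ℕ | ∃ (m : ℕ) (r : Fin m → R), Isometric d (osum (hypform k) r)}

/-- `r` is a subform of `d`: `d ≅ r ⊥ s` for some (nondegenerate) form `s`. -/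
def Subform {m n : ℕ} (r : Fin m → R) (d : Fin n → R) : Prop :=
  ∃ (k : ℕ) (s : Fin k → R), Nondeg s ∧ Isometric d (osum r s)

/-- The set of nonzero represented values. -/
def Dset {n : ℕ} (d : Fin n → R) : Set R :=
  {a | a ≠ 0 ∧ ∃ v : Fin n → R, evalQF d v = a}

/-- The group of similarity factors `G(q) = {a : a·q ≅ q}`. -/
def Gset {n : ℕ} (d : Fin n → R) : Set R :=
  {a | a ≠ 0 ∧ Isometric (smulQF a d) d}

/-- `H(q) = {a : ⟨1,-a⟩ ⊗ q is isotropic}`. -/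
def Hset {n : ℕ} (d : Fin n → R) : Set R :=
  {a | a ≠ 0 ∧ Isotropic (tensorQF ![1, -a] d)}

/-- Base change of a form along a ring homomorphism (e.g. a field extension). -/
def bc {S : Type*} [CommRing S] (f : R →+* S) {n : ℕ} (d : Fin n → R) : Fin n → S :=
  fun i => f (d i)

/-- The Pfister form `⟨1,a 0⟩ ⊗ ⋯ ⊗ ⟨1, a (n-1)⟩`: its `2^n` diagonal coefficients are
the products `∏_{j ∈ S} a j` over subsets `S` of the index set. -/
noncomputable def pfisterOf {n : ℕ} (a : Fin n → R) : Fin (2 ^ n) → R :=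
  fun i => ∏ j : Fin n, if (finFunctionFinEquiv.symm i) j = 0 then 1 else a j

/-- `π` is an `n`-fold Pfister form. -/
def IsNPfister (n : ℕ) {m : ℕ} (π : Fin m → R) : Prop :=
  ∃ a : Fin n → R, (∀ i, a i ≠ 0) ∧ Isometric π (pfisterOf a)

/-- `π` is a Pfister form. -/
def IsPfister {m : ℕ} (π : Fin m → R) : Prop := ∃ n : ℕ, IsNPfister n π

end Defs

/-- The quadric polynomial `p(X₁,…,Xₙ) = ∑ dᵢ Xᵢ²` attached to a diagonal form. -/
noncomputable def formPoly {F : Type*} [CommRing F] {n : ℕ} (d : Fin n → F) :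
    MvPolynomial (Fin n) F :=
  ∑ i, MvPolynomial.C (d i) * MvPolynomial.X i ^ 2

/-- The affine coordinate ring `F[X₁,…,Xₙ]/(p(X))` of the quadric `p = 0`. -/
abbrev CoordRing {F : Type*} [CommRing F] {n : ℕ} (d : Fin n → F) : Type _ :=
  MvPolynomial (Fin n) F ⧸ Ideal.span {formPoly d}

/-- The function field `F(p)` of the quadric `p = 0`: the total fraction ring of the
coordinate ring (the quotient field when the coordinate ring is a domain, i.e. when `p` is
anisotropic of dimension at least 2). -/
abbrev FunField {F : Type*} [Field F] {n : ℕ} (d : Fin n → F) : Type _ :=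
  FractionRing (CoordRing d)

end QF


namespace QF

section Bilinear

variable {R : Type*} [CommRing R]

/-- The symmetric bilinear form `∑ dᵢ xᵢ yᵢ` attached to a diagonal form. -/
noncomputable def bilin {n : ℕ} (d : Fin n → R) : (Fin n → R) →ₗ[R] (Fin n → R) →ₗ[R] R :=
  LinearMap.mk₂ R (fun x y => ∑ i, d i * x i * y i)
    (fun x x' y => by simp [mul_add, add_mul, Finset.sum_add_distrib])
    (fun c x y => by
      simp only [Pi.smul_apply, smul_eq_mul, Finset.mul_sum]
      exact Finset.sum_congr rfl fun i _ => by ring)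
    (fun x y y' => by simp [mul_add, Finset.sum_add_distrib])
    (fun c x y => by
      simp only [Pi.smul_apply, smul_eq_mul, Finset.mul_sum]
      exact Finset.sum_congr rfl fun i _ => by ring)

theorem bilin_apply {n : ℕ} (d x y : Fin n → R) : bilin d x y = ∑ i, d i * x i * y i := rfl

theorem bilin_self {n : ℕ} (d x : Fin n → R) : bilin d x x = evalQF d x := by
  simp only [bilin_apply, evalQF]
  exact Finset.sum_congr rfl fun i _ => by ring

theorem bilin_comm {n : ℕ} (d x y : Fin n → R) : bilin d x y = bilin d y x := by
  simp only [bilin_apply]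
  exact Finset.sum_congr rfl fun i _ => by ring

theorem evalQF_add {n : ℕ} (d x y : Fin n → R) :
    evalQF d (x + y) = evalQF d x + 2 * bilin d x y + evalQF d y := by
  simp only [← bilin_self, map_add, LinearMap.add_apply, bilin_comm d y x]
  ring

theorem bilin_single_left {n : ℕ} (d : Fin n → R) (i : Fin n) (y : Fin n → R) :
    bilin d (Pi.single i 1) y = d i * y i := by
  rw [bilin_apply, Finset.sum_eq_single i]
  · simp
  · intro j _ hj
    simp [Pi.single_eq_of_ne hj]
  · simp

theorem evalQF_append {m n : ℕ} (d x : Fin m → R) (e y : Fin n → R) :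
    evalQF (osum d e) (Fin.append x y) = evalQF d x + evalQF e y := by
  simp [evalQF, osum, Fin.sum_univ_add]

theorem Isometric.symm {m n : ℕ} {d : Fin m → R} {e : Fin n → R} (h : Isometric d e) :
    Isometric e d := by
  obtain ⟨φ, hφ⟩ := h
  exact ⟨φ.symm, fun v => by rw [← hφ, LinearEquiv.apply_symm_apply]⟩

/-- A form has a totally isotropic subspace of dimension `k`. -/
def HasTotIso {n : ℕ} (k : ℕ) (d : Fin n → R) : Prop :=
  ∃ f : (Fin k → R) →ₗ[R] (Fin n → R), Function.Injective f ∧ ∀ x, evalQF d (f x) = 0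

theorem hasTotIso_of_isometric {n k m : ℕ} {d : Fin n → R} {r : Fin m → R}
    (h : Isometric d (osum (hypform k) r)) : HasTotIso k d := by
  obtain ⟨φ, hφ⟩ := h.symm
  let g : (Fin k → R) →ₗ[R] (Fin ((k + k) + m) → R) :=
    { toFun := fun x => Fin.append (Fin.append x x) 0
      map_add' := fun x y => by
        ext i
        refine Fin.addCases (fun i => ?_) (fun i => ?_) i
        · refine Fin.addCases (fun i => ?_) (fun i => ?_) i <;> simp [-Fin.natAdd_eq_addNat]
        · simp
      map_smul' := fun c x => by
        ext i
        refine Fin.addCases (fun i => ?_) (fun i => ?_) i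
        · refine Fin.addCases (fun i => ?_) (fun i => ?_) i <;> simp [-Fin.natAdd_eq_addNat]
        · simp }
  refine ⟨φ.toLinearMap ∘ₗ g, φ.injective.comp fun x y hxy => ?_, fun x => ?_⟩
  · ext i
    simpa [g] using congrFun hxy (Fin.castAdd m (Fin.castAdd k i))
  · change evalQF d (φ (Fin.append (Fin.append x x) 0)) = 0
    rw [hφ, evalQF_append]
    change evalQF (osum _ _) _ + _ = 0
    rw [evalQF_append]
    simp [evalQF]

end Bilinear

section Witt

variable {K : Type*} [Field K]

theorem bilin_map_eq (h2 : (2 : K) ≠ 0) {m n : ℕ} {h : Fin m → K} {d : Fin n → K}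
    (g : (Fin m → K) →ₗ[K] (Fin n → K)) (hg : ∀ x, evalQF d (g x) = evalQF h x)
    (x y : Fin m → K) : bilin d (g x) (g y) = bilin h x y := by
  have h1 := hg (x + y)
  rw [map_add, evalQF_add, evalQF_add, hg, hg] at h1
  exact mul_left_cancel₀ h2 (by linear_combination h1)

/-- A nondegenerate form that embeds isometrically splits off as an orthogonal summand. -/
theorem exists_isometric_osum (h2 : (2 : K) ≠ 0) {m n : ℕ} {h : Fin m → K} {d : Fin n → K}
    (hh : Nondeg h) (g : (Fin m → K) →ₗ[K] (Fin n → K))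
    (hg : ∀ x, evalQF d (g x) = evalQF h x) :
    ∃ (l : ℕ) (r : Fin l → K), Isometric d (osum h r) := by
  have hb := bilin_map_eq h2 g hg
  let π : (Fin n → K) →ₗ[K] (Fin m → K) :=
    LinearMap.pi fun i => (h i)⁻¹ • bilin d (g (Pi.single i 1))
  have hπ : ∀ x i, π x i = (h i)⁻¹ * bilin d (g (Pi.single i 1)) x := fun x i => rfl
  have hπg : ∀ y, π (g y) = y := by
    intro y
    ext i
    rw [hπ, hb, bilin_single_left, inv_mul_cancel_left₀ (hh i)]
  have horth : ∀ x w, π w = 0 → bilin d (g x) w = 0 := by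
    intro x w hw
    have : (bilin d).flip w ∘ₗ g = 0 := by
      refine LinearMap.pi_ext' fun i => LinearMap.ext_ring ?_
      have := congrFun hw i
      rw [hπ] at this
      simpa [hh i] using this
    exact LinearMap.congr_fun this x
  let W := LinearMap.ker π
  have : Invertible (2 : K) := invertibleOfNonzero h2
  obtain ⟨r, ⟨e⟩⟩ := QuadraticForm.equivalent_weightedSumSquares
    ((QuadraticMap.weightedSumSquares K d).comp W.subtype)
  refine ⟨_, r, Isometric.symm ?_⟩
  have he : ∀ v, evalQF d (e.symm v : Fin n → K) = evalQF r v := by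
    intro v
    have := e.symm.map_app v
    simp only [QuadraticMap.comp_apply, QuadraticMap.weightedSumSquares_apply, smul_eq_mul,
      ← sq] at this
    exact this
  let ψ : (Fin (m + Module.finrank K W) → K) →ₗ[K] (Fin n → K) :=
    g ∘ₗ LinearMap.funLeft K K (Fin.castAdd _) +
      W.subtype ∘ₗ e.symm.toLinearEquiv.toLinearMap ∘ₗ LinearMap.funLeft K K (Fin.natAdd m)
  have hψ : ∀ x y, ψ (Fin.append x y) = g x + (e.symm y : Fin n → K) := by
    intro x y
    have h1 : LinearMap.funLeft K K (Fin.castAdd (Module.finrank K W)) (Fin.append x y) = x := by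
      ext i; simp [LinearMap.funLeft_apply]
    have h3 : LinearMap.funLeft K K (Fin.natAdd m) (Fin.append x y) = y := by
      ext i; simp [LinearMap.funLeft_apply]
    simp only [ψ, LinearMap.add_apply, LinearMap.comp_apply, h1, h3]
    rfl
  have hsplit : ∀ z : Fin (m + Module.finrank K W) → K, ∃ x y, z = Fin.append x y := fun z =>
    ⟨_, _, (Fin.append_castAdd_natAdd (f := z)).symm⟩
  have hker : ∀ w : W, π w = 0 := fun w => w.2
  have hbij : Function.Bijective ψ := by
    constructor
    · rw [← LinearMap.ker_eq_bot, LinearMap.ker_eq_bot']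
      intro z hz
      obtain ⟨x, y, rfl⟩ := hsplit z
      rw [hψ] at hz
      have hx : x = 0 := by
        have := congrArg π hz
        rwa [map_add, hπg, hker, add_zero, map_zero] at this
      subst hx
      rw [map_zero, zero_add] at hz
      have hy : e.symm y = 0 := Subtype.ext hz
      have hy : y = 0 := e.symm.toLinearEquiv.map_eq_zero_iff.1 hy
      subst hy
      ext i
      refine Fin.addCases (fun i => ?_) (fun i => ?_) i <;> simp [-Fin.natAdd_eq_addNat]
    · intro x
      have hw : π (x - g (π x)) = 0 := by rw [map_sub, hπg, sub_self]
      refine ⟨Fin.append (π x) (e ⟨x - g (π x), hw⟩), ?_⟩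
      have : e.symm (e ⟨x - g (π x), hw⟩) = ⟨x - g (π x), hw⟩ :=
        e.toLinearEquiv.symm_apply_apply _
      rw [hψ, this]
      simp
  refine ⟨LinearEquiv.ofBijective ψ hbij, fun z => ?_⟩
  obtain ⟨x, y, rfl⟩ := hsplit z
  rw [LinearEquiv.ofBijective_apply, hψ, evalQF_append, evalQF_add, horth _ _ (hker _), he, hg]
  ring

theorem nondeg_hypform (k : ℕ) : Nondeg (hypform k : Fin (k + k) → K) := by
  intro i
  refine Fin.addCases (fun i => ?_) (fun i => ?_) i <;> simp [hypform, -Fin.natAdd_eq_addNat]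

/-- A totally isotropic subspace of dimension `k` of a nondegenerate form is contained in
an orthogonal sum of `k` hyperbolic planes. -/
theorem HasTotIso.exists_isometric (h2 : (2 : K) ≠ 0) {n k : ℕ} {d : Fin n → K}
    (hd : Nondeg d) (h : HasTotIso k d) :
    ∃ (m : ℕ) (r : Fin m → K), Isometric d (osum (hypform k) r) := by
  obtain ⟨f, hf, hiso⟩ := h
  obtain ⟨c, hc⟩ := f.exists_leftInverse_of_injective (LinearMap.ker_eq_bot.2 hf)
  let w : Fin k → Fin n → K := fun j l => (d l)⁻¹ * c (Pi.single l 1) j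
  have hw : ∀ j x, bilin d (w j) (f x) = x j := by
    intro j x
    have h1 : bilin d (w j) = LinearMap.proj j ∘ₗ c := by
      refine LinearMap.pi_ext' fun l => LinearMap.ext_ring ?_
      simp [bilin_comm d (w j), bilin_single_left, w, hd l]
    rw [h1, LinearMap.comp_apply, ← LinearMap.comp_apply c f, hc]
    rfl
  let s : (Fin k → K) →ₗ[K] (Fin n → K) := Fintype.linearCombination K w
  have hs : ∀ x y, bilin d (s x) y = ∑ j, x j * bilin d (w j) y := by
    intro x y
    simp [s, Fintype.linearCombination_apply]
  let τ : (Fin k → K) →ₗ[K] (Fin k → K) := LinearMap.pi fun j => bilin d (w j) ∘ₗ s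
  have hτ : ∀ x j, τ x j = bilin d (w j) (s x) := fun x j => rfl
  let p₁ : (Fin (k + k) → K) →ₗ[K] (Fin k → K) := LinearMap.funLeft K K (Fin.castAdd k)
  let p₂ : (Fin (k + k) → K) →ₗ[K] (Fin k → K) := LinearMap.funLeft K K (Fin.natAdd k)
  let g : (Fin (k + k) → K) →ₗ[K] (Fin n → K) :=
    f ∘ₗ ((2 : K)⁻¹ • (p₁ + p₂ - τ ∘ₗ (p₁ - p₂))) + s ∘ₗ (p₁ - p₂)
  refine exists_isometric_osum h2 (nondeg_hypform k) g fun z => ?_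
  set b := p₁ z - p₂ z with hb
  have hgz : g z = f ((2 : K)⁻¹ • (p₁ z + p₂ z - τ b)) + s b := rfl
  rw [hgz, evalQF_add, hiso, bilin_comm, hs, ← bilin_self d (s b), hs]
  simp only [hw, ← hτ]
  rw [zero_add, Finset.mul_sum, ← Finset.sum_add_distrib]
  have : evalQF (hypform k) z = ∑ j, ((p₁ z j) ^ 2 - (p₂ z j) ^ 2) := by
    simp [-Fin.natAdd_eq_addNat, evalQF, hypform, Fin.sum_univ_add, p₁, p₂,
      LinearMap.funLeft_apply, sub_eq_add_neg, Finset.sum_add_distrib]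
  rw [this]
  refine Finset.sum_congr rfl fun j _ => ?_
  simp only [hb, Pi.smul_apply, Pi.sub_apply, Pi.add_apply, smul_eq_mul]
  field_simp
  ring

theorem wittIndex_le_of_hasTotIso {L : Type*} [Field L] (h2 : (2 : L) ≠ 0) {m n : ℕ}
    {d : Fin m → K} {e : Fin n → L} (he : Nondeg e)
    (h : ∀ k, HasTotIso k d → HasTotIso k e) : WittIndex d ≤ WittIndex e := by
  unfold WittIndex
  rcases Set.eq_empty_or_nonempty
    {k : ℕ | ∃ (m : ℕ) (r : Fin m → K), Isometric d (osum (hypform k) r)} with h0 | h0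
  · rw [h0]; simp
  · refine csSup_le_csSup ⟨n, ?_⟩ h0 ?_
    · rintro k ⟨l, r, φ, -⟩
      have := φ.finrank_eq
      simp at this
      omega
    · rintro k ⟨l, r, hk⟩
      exact (h k (hasTotIso_of_isometric hk)).exists_isometric h2 he

end Witt

section Specialization

theorem map_evalQF {R S : Type*} [CommRing R] [CommRing S] (f : R →+* S) {n : ℕ}
    (d v : Fin n → R) : f (evalQF d v) = evalQF (bc f d) (fun i => f (v i)) := by
  simp [evalQF, bc]

theorem bc_comp {R S T : Type*} [CommRing R] [CommRing S] [CommRing T] (f : R →+* S)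
    (g : S →+* T) {n : ℕ} (d : Fin n → R) : bc g (bc f d) = bc (g.comp f) d := rfl

/-- Totally isotropic subspaces over the fraction field `K` of a principal ideal domain `O`
specialise along a surjection from `O` to a field whose kernel is generated by `t`. -/
theorem HasTotIso.specialize {O K κ : Type*} [CommRing O] [IsDomain O] [IsPrincipalIdealRing O]
    [Field K] [Field κ] [Algebra O K] [IsFractionRing O K] (π : O →+* κ)
    (hπ : Function.Surjective π) (t : O) (ht : ∀ x, π x = 0 ↔ t ∣ x) {n k : ℕ}
    (d : Fin n → O) (h : HasTotIso k (bc (algebraMap O K) d)) : HasTotIso k (bc π d) := by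
  obtain ⟨f, hf, hiso⟩ := h
  have hinj : Function.Injective (algebraMap O K) := IsFractionRing.injective O K
  let J : (Fin n → O) →ₗ[O] (Fin n → K) :=
    LinearMap.pi fun i => Algebra.linearMap O K ∘ₗ LinearMap.proj i
  have hJ : ∀ v i, J v i = algebraMap O K (v i) := fun v i => rfl
  have hJinj : Function.Injective J := fun v w hvw => by
    ext i
    exact hinj (by rw [← hJ, ← hJ, hvw])
  let M : Submodule O (Fin n → O) := ((LinearMap.range f).restrictScalars O).comap J
  have hMiso : ∀ v ∈ M, evalQF d v = 0 := by
    rintro v ⟨x, hx⟩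
    apply hinj
    rw [map_evalQF, map_zero, ← hiso x, hx]
    rfl
  have hMsat : ∀ (a : O) (v : Fin n → O), a ≠ 0 → a • v ∈ M → v ∈ M := by
    intro a v ha hv
    have h0 : algebraMap O K a ≠ 0 := (map_ne_zero_iff _ hinj).2 ha
    change J (a • v) ∈ LinearMap.range f at hv
    change J v ∈ LinearMap.range f
    rw [map_smul, ← algebraMap_smul K a (J v)] at hv
    exact ((LinearMap.range f).smul_mem_iff h0).1 hv
  obtain ⟨m, ⟨b⟩⟩ := Submodule.nonempty_basis_of_pid (Pi.basisFun O (Fin n)) M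
  have hkm : k ≤ m := by
    have hex : ∀ j : Fin k, ∃ (c : O) (v : M), c ≠ 0 ∧
        J v = algebraMap O K c • f (Pi.single j 1) := by
      intro j
      obtain ⟨c, hc⟩ := IsLocalization.exist_integer_multiples_of_finite (nonZeroDivisors O)
        (f (Pi.single j 1))
      choose v hv using hc
      have hv' : J v = algebraMap O K c • f (Pi.single j 1) := by
        ext i
        rw [hJ, hv]
        simp [Algebra.smul_def]
      refine ⟨c, ⟨v, ?_⟩, nonZeroDivisors.ne_zero c.2, hv'⟩
      change J v ∈ LinearMap.range f
      rw [hv']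
      exact Submodule.smul_mem _ _ ⟨_, rfl⟩
    choose c v hc hv using hex
    have hli : LinearIndependent O v := by
      rw [Fintype.linearIndependent_iff]
      intro a ha j
      have h1 : f (fun j => algebraMap O K (a j * c j)) = 0 := by
        rw [LinearMap.pi_apply_eq_sum_univ f]
        have h3 := congrArg (fun w : M => J w) ha
        simp only [Submodule.coe_sum, Submodule.coe_smul, map_sum, map_smul, hv,
          Submodule.coe_zero, map_zero] at h3
        rw [← h3]
        refine Finset.sum_congr rfl fun j _ => ?_
        rw [map_mul, mul_smul, algebraMap_smul]
        congr 3
        ext i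
        simp [Pi.single_apply, eq_comm]
      have h3 := congrFun (hf (h1.trans (map_zero f).symm)) j
      have h4 := hinj (h3.trans (map_zero _).symm)
      exact (mul_eq_zero.1 h4).resolve_right (hc j)
    have : Module.Finite O M := Module.Finite.of_basis b
    simpa [Module.finrank_eq_card_basis b] using hli.fintype_card_le_finrank
  let ι : Fin k → Fin m := Fin.castLE hkm
  let u : Fin k → Fin n → κ := fun j i => π ((b (ι j) : Fin n → O) i)
  have hu : ∀ a : Fin k → O, ∀ i, Fintype.linearCombination κ u (fun j => π (a j)) i =
      π ((∑ j, a j • b (ι j) : M).1 i) := by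
    intro a i
    simp [Fintype.linearCombination_apply, u]
  have hlift : ∀ x : Fin k → κ, ∃ a : Fin k → O, (fun j => π (a j)) = x := fun x =>
    ⟨fun j => (hπ (x j)).choose, funext fun j => (hπ (x j)).choose_spec⟩
  refine ⟨Fintype.linearCombination κ u, ?_, ?_⟩
  · rw [← LinearMap.ker_eq_bot, LinearMap.ker_eq_bot']
    intro x hx
    obtain ⟨a, rfl⟩ := hlift x
    have hbι : LinearIndependent O (fun j => b (ι j)) :=
      b.linearIndependent.comp ι (Fin.castLE_injective hkm)
    have hdvd : ∀ i, t ∣ (∑ j, a j • b (ι j) : M).1 i := fun i => by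
      rw [← ht, ← hu, hx]
      rfl
    choose z hz using hdvd
    have hz' : (∑ j, a j • b (ι j) : M).1 = t • z := funext hz
    ext j
    change π (a j) = 0
    by_cases ht0 : t = 0
    · have h0 : (∑ j, a j • b (ι j) : M) = 0 := Subtype.ext (by rw [hz', ht0, zero_smul]; rfl)
      rw [Fintype.linearIndependent_iff.1 hbι a h0 j, map_zero]
    · have hzM : z ∈ M := hMsat t z ht0 (hz' ▸ Subtype.prop _)
      have h0 : (∑ j, a j • b (ι j) : M) = t • ⟨z, hzM⟩ := Subtype.ext hz'
      rw [ht]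
      have h1 := congrArg (fun w => b.repr w (ι j)) h0
      simp only [map_sum, map_smul, Finsupp.coe_finsetSum, Finset.sum_apply, Finsupp.smul_apply,
        Module.Basis.repr_self, smul_eq_mul] at h1
      rw [Finset.sum_eq_single j] at h1
      · rw [Finsupp.single_eq_same, mul_one] at h1
        exact ⟨_, h1⟩
      · intro j' _ hj'
        rw [Finsupp.single_eq_of_ne, mul_zero]
        exact fun hh => hj' (Fin.castLE_injective hkm hh).symm
      · simp
  · intro x
    obtain ⟨a, rfl⟩ := hlift x
    rw [funext (hu a), ← map_evalQF, hMiso _ (Subtype.prop _), map_zero]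

/-- Let `A → B` be a surjection of Noetherian domains with principal kernel. Totally isotropic
subspaces over the fraction field of `A` specialise to the fraction field of `B`. -/
theorem HasTotIso.specialize_fractionRing {A B K κ : Type*} [CommRing A] [IsDomain A]
    [IsNoetherianRing A] [CommRing B] [IsDomain B] [Field K] [Algebra A K] [IsFractionRing A K]
    [Field κ] [Algebra B κ] [IsFractionRing B κ] (φ : A →+* B) (hφ : Function.Surjective φ)
    (t : A) (ht : ∀ x, φ x = 0 ↔ t ∣ x) {n k : ℕ} (d : Fin n → A)
    (h : HasTotIso k (bc (algebraMap A K) d)) :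
    HasTotIso k (bc ((algebraMap B κ).comp φ) d) := by
  have hinjB : Function.Injective (algebraMap B κ) := IsFractionRing.injective B κ
  let P : Ideal A := RingHom.ker φ
  have hP : P.IsPrime := RingHom.ker_isPrime φ
  have hPt : P = Ideal.span {t} := by
    ext x
    rw [RingHom.mem_ker, ht, Ideal.mem_span_singleton]
  let O := Localization.AtPrime P
  have hle : P.primeCompl ≤ nonZeroDivisors A := P.primeCompl_le_nonZeroDivisors
  have : IsDomain O := IsLocalization.isDomain_localization hle
  have : IsNoetherianRing O := IsLocalization.isNoetherianRing P.primeCompl O inferInstance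
  have : IsPrincipalIdealRing O := by
    refine ((tfae_of_isNoetherianRing_of_isLocalRing_of_isDomain O).out 0 4).2 ?_
    have hmap : Ideal.map (algebraMap A O) P = Ideal.span {algebraMap A O t} := by
      simp only [hPt, Ideal.map_span, Set.image_singleton]
    rw [← Localization.AtPrime.map_eq_maximalIdeal]
    exact ⟨⟨_, hmap⟩⟩
  let _ : Algebra O K := (IsLocalization.lift (M := P.primeCompl) (g := algebraMap A K)
    fun y => (IsUnit.mk0 _ ((map_ne_zero_iff _ (IsFractionRing.injective A K)).2
      (nonZeroDivisors.ne_zero (hle y.2))))).toAlgebra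
  have : IsScalarTower A O K := IsScalarTower.of_algebraMap_eq fun x =>
    (IsLocalization.lift_eq _ x).symm
  have : IsFractionRing O K :=
    IsFractionRing.isFractionRing_of_isDomain_of_isLocalization P.primeCompl O K
  have hunit : ∀ y : P.primeCompl, IsUnit ((algebraMap B κ).comp φ y) := fun y =>
    IsUnit.mk0 _ ((map_ne_zero_iff _ hinjB).2 y.2)
  let π : O →+* κ := IsLocalization.lift hunit
  have hπA : ∀ x, π (algebraMap A O x) = algebraMap B κ (φ x) := IsLocalization.lift_eq hunit
  have hπ : Function.Surjective π := by
    intro x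
    obtain ⟨a, b, hb, rfl⟩ := IsFractionRing.div_surjective (A := B) x
    obtain ⟨a, rfl⟩ := hφ a
    obtain ⟨b, rfl⟩ := hφ b
    have hb' : b ∈ P.primeCompl := nonZeroDivisors.ne_zero hb
    refine ⟨IsLocalization.mk' O a (⟨b, hb'⟩ : P.primeCompl), ?_⟩
    rw [IsLocalization.lift_mk'_spec, RingHom.comp_apply, RingHom.comp_apply, mul_div_cancel₀]
    exact (map_ne_zero_iff _ hinjB).2 hb'
  have hker : ∀ x, π x = 0 ↔ algebraMap A O t ∣ x := by
    intro x
    constructor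
    · intro hx
      obtain ⟨a, s, rfl⟩ := IsLocalization.exists_mk'_eq P.primeCompl x
      rw [IsLocalization.lift_mk'_spec, mul_zero, RingHom.comp_apply,
        map_eq_zero_iff _ hinjB, ht] at hx
      obtain ⟨y, rfl⟩ := hx
      exact ⟨IsLocalization.mk' O y s, by rw [IsLocalization.mul_mk'_eq_mk'_of_mul]⟩
    · rintro ⟨y, rfl⟩
      rw [map_mul, hπA, (ht t).2 dvd_rfl, map_zero, zero_mul]
  have h1 : bc (algebraMap A K) d = bc (algebraMap O K) (bc (algebraMap A O) d) := by
    rw [bc_comp, ← IsScalarTower.algebraMap_eq]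
  have h3 : bc ((algebraMap B κ).comp φ) d = bc π (bc (algebraMap A O) d) :=
    funext fun i => (hπA (d i)).symm
  rw [h3]
  exact HasTotIso.specialize π hπ _ hker _ (h1 ▸ h)

end Specialization

section CoordinateRing

open MvPolynomial

variable {F : Type*} [Field F]

theorem aeval_formPoly {S : Type*} [CommRing S] [Algebra F S] {n : ℕ} (d : Fin n → F)
    (x : Fin n → S) : aeval x (formPoly d) = evalQF (bc (algebraMap F S) d) x := by
  simp [formPoly, evalQF, bc]

/-- The homomorphism from the coordinate ring given by an isotropic vector. -/
noncomputable def coordLift {S : Type*} [CommRing S] [Algebra F S] {n : ℕ} (d : Fin n → F)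
    (x : Fin n → S) (hx : evalQF (bc (algebraMap F S) d) x = 0) : CoordRing d →ₐ[F] S :=
  Ideal.Quotient.liftₐ _ (aeval x) fun a ha => by
    obtain ⟨b, rfl⟩ := Ideal.mem_span_singleton.1 ha
    rw [map_mul, aeval_formPoly, hx, zero_mul]

/-- The coordinate functions of the quadric. -/
noncomputable def coord {n : ℕ} (d : Fin n → F) (i : Fin n) : CoordRing d :=
  Ideal.Quotient.mk _ (X i)

theorem coordLift_coord {S : Type*} [CommRing S] [Algebra F S] {n : ℕ} (d : Fin n → F)
    (x : Fin n → S) (hx : evalQF (bc (algebraMap F S) d) x = 0) (i : Fin n) :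
    coordLift d x hx (coord d i) = x i :=
  aeval_X x i

theorem coordRing_algHom_ext {S : Type*} [CommRing S] [Algebra F S] {n : ℕ} {d : Fin n → F}
    {f g : CoordRing d →ₐ[F] S} (h : ∀ i, f (coord d i) = g (coord d i)) : f = g :=
  Ideal.Quotient.algHom_ext _ (MvPolynomial.algHom_ext h)

theorem evalQF_coord {n : ℕ} (d : Fin n → F) :
    evalQF (bc (algebraMap F (CoordRing d)) d) (coord d) = 0 := by
  have h1 : aeval (coord d) = Ideal.Quotient.mkₐ F (Ideal.span {formPoly d}) :=
    MvPolynomial.algHom_ext fun i => aeval_X _ i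
  rw [← aeval_formPoly, h1]
  exact Ideal.Quotient.eq_zero_iff_mem.2 (Ideal.mem_span_singleton_self _)

theorem coordRing_surjective {S : Type*} [CommRing S] [Algebra F S] {n : ℕ} {d : Fin n → F}
    (f : S →ₐ[F] CoordRing d) (h : ∀ i, ∃ s, f s = coord d i) : Function.Surjective f := by
  choose s hs using h
  intro y
  obtain ⟨y, rfl⟩ := Ideal.Quotient.mk_surjective y
  have h1 : f.comp (aeval s) = Ideal.Quotient.mkₐ F (Ideal.span {formPoly d}) :=
    MvPolynomial.algHom_ext fun i => by
      rw [AlgHom.comp_apply, aeval_X]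
      exact hs i
  exact ⟨aeval s y, DFunLike.congr_fun h1 y⟩

/-- The quadric of an anisotropic form of dimension at least two is irreducible. -/
theorem prime_formPoly {n : ℕ} {d : Fin n → F} (hd : Nondeg d) (han : Anisotropic d)
    (hn : 2 ≤ n) : Prime (formPoly d) := by
  obtain ⟨m, rfl⟩ : ∃ m, n = (m + 1) + 1 := ⟨n - 2, by omega⟩
  rw [← MulEquiv.prime_iff (finSuccEquiv F (m + 1))]
  set c : MvPolynomial (Fin (m + 1)) F := C (d 0)⁻¹ * formPoly (fun i => d i.succ) with hc
  have hd0 : (C (d 0) * C (d 0)⁻¹ : MvPolynomial (Fin (m + 1)) F) = 1 := by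
    rw [← C_mul, mul_inv_cancel₀ (hd 0), C_1]
  have hp : finSuccEquiv F (m + 1) (formPoly d) =
      Polynomial.C (C (d 0)) * (Polynomial.X ^ 2 + Polynomial.C c) := by
    rw [formPoly, Fin.sum_univ_succ, map_add, map_sum]
    simp only [map_mul, map_pow, finSuccEquiv_X_zero, finSuccEquiv_X_succ]
    have hC : ∀ a : F, finSuccEquiv F (m + 1) (C a) = Polynomial.C (C a) := fun a => by
      simp [finSuccEquiv_apply]
    simp only [hC]
    rw [mul_add, ← Polynomial.C_mul, hc, ← mul_assoc, hd0, one_mul, formPoly, map_sum]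
    simp only [map_mul, map_pow]
  have hu : IsUnit (Polynomial.C (C (d 0)) : Polynomial (MvPolynomial (Fin (m + 1)) F)) :=
    Polynomial.isUnit_C.2 (IsUnit.of_mul_eq_one _ hd0)
  rw [hp]
  refine (Associated.prime_iff (associated_unit_mul_right _ _ hu)).1 (Irreducible.prime ?_)
  have hmon : (Polynomial.X ^ 2 + Polynomial.C c).Monic :=
    Polynomial.monic_X_pow_add_C c two_ne_zero
  have hdeg : (Polynomial.X ^ 2 + Polynomial.C c).natDegree = 2 :=
    Polynomial.natDegree_X_pow_add_C
  rw [hmon.irreducible_iff_roots_eq_zero_of_degree_le_three hdeg.ge (by omega),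
    Multiset.eq_zero_iff_forall_notMem]
  intro g hg
  have hg0 := (Polynomial.mem_roots'.1 hg).2
  simp only [Polynomial.IsRoot.def, Polynomial.eval_add, Polynomial.eval_pow, Polynomial.eval_X,
    Polynomial.eval_C] at hg0
  let e : Fin (m + 1) → F := Pi.single 0 1
  have h1 := congrArg (aeval e) hg0
  simp only [hc, map_add, map_pow, map_mul, aeval_formPoly, map_zero, aeval_C,
    Algebra.algebraMap_self, RingHom.id_apply] at h1
  refine han ⟨Fin.cons (aeval e g) e, fun h0 => ?_, ?_⟩
  · have := congrFun h0 (Fin.succ 0)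
    simp [e] at this
  · rw [evalQF, Fin.sum_univ_succ]
    simp only [Fin.cons_zero, Fin.cons_succ]
    have h3 : evalQF (bc (RingHom.id F) fun i => d i.succ) e =
        ∑ i : Fin (m + 1), d i.succ * e i ^ 2 := rfl
    rw [h3] at h1
    have := hd 0
    field_simp at h1
    linear_combination h1

theorem isDomain_coordRing {n : ℕ} {d : Fin n → F} (hd : Nondeg d) (han : Anisotropic d)
    (hn : 2 ≤ n) : IsDomain (CoordRing d) := by
  have hp := prime_formPoly hd han hn
  have := (Ideal.span_singleton_prime hp.ne_zero).2 hp
  exact Ideal.Quotient.isDomain _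

theorem two_ne_zero_of_algebra {S : Type*} [CommRing S] [Nontrivial S] [Algebra F S]
    (h2 : (2 : F) ≠ 0) : (2 : S) ≠ 0 := by
  rw [← map_ofNat (algebraMap F S) 2]
  exact (map_ne_zero _).2 h2

theorem wittIndex_le_of_surjective (h2 : (2 : F) ≠ 0) {m n l : ℕ} {p : Fin m → F} {r : Fin n → F}
    {q : Fin l → F} (hp : IsDomain (CoordRing p)) (hr : IsDomain (CoordRing r)) (hq : Nondeg q)
    (φ : CoordRing p →ₐ[F] CoordRing r) (hφ : Function.Surjective φ) (t : CoordRing p)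
    (ht : ∀ x, φ x = 0 ↔ t ∣ x) :
    WittIndex (bc (algebraMap F (FunField p)) q) ≤
      WittIndex (bc (algebraMap F (FunField r)) q) := by
  refine wittIndex_le_of_hasTotIso (two_ne_zero_of_algebra (F := F) h2)
    (fun i => (map_ne_zero (algebraMap F (FunField r))).2 (hq i)) fun k hk => ?_
  have h1 : bc (algebraMap F (FunField p)) q =
      bc (algebraMap (CoordRing p) (FunField p)) (bc (algebraMap F (CoordRing p)) q) := by
    rw [bc_comp, ← IsScalarTower.algebraMap_eq]
  have h3 : bc (algebraMap F (FunField r)) q =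
      bc ((algebraMap (CoordRing r) (FunField r)).comp (φ : CoordRing p →+* CoordRing r))
        (bc (algebraMap F (CoordRing p)) q) := by
    rw [bc_comp, RingHom.comp_assoc, AlgHom.comp_algebraMap, ← IsScalarTower.algebraMap_eq]
  rw [h1] at hk
  rw [h3]
  exact hk.specialize_fractionRing (φ : CoordRing p →+* CoordRing r) hφ t ht

theorem evalQF_bc_castSucc {S : Type*} [CommRing S] [Algebra F S] {n : ℕ} (p : Fin (n + 1) → F)
    (x : Fin (n + 1) → S) : evalQF (bc (algebraMap F S) p) x =
      evalQF (bc (algebraMap F S) (fun i : Fin n => p i.castSucc)) (fun i => x i.castSucc) +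
        algebraMap F S (p (Fin.last n)) * x (Fin.last n) ^ 2 := by
  simp only [evalQF, bc, Fin.sum_univ_castSucc]

/-- The hyperplane section `Xₙ = 0` of the quadric `p = 0` is the quadric of the form obtained
by dropping the last coefficient. -/
theorem exists_coordRing_surjection {n : ℕ} (p : Fin (n + 1) → F) :
    ∃ (φ : CoordRing p →ₐ[F] CoordRing (fun i : Fin n => p i.castSucc)) (t : CoordRing p),
      Function.Surjective φ ∧ ∀ x, φ x = 0 ↔ t ∣ x := by
  set d : Fin n → F := fun i => p i.castSucc with hd
  let φ : CoordRing p →ₐ[F] CoordRing d := coordLift p (Fin.snoc (coord d) 0) (by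
    rw [evalQF_bc_castSucc]
    simpa using evalQF_coord d)
  have hφ : ∀ i, φ (coord p i) = (Fin.snoc (coord d) 0 : Fin (n + 1) → CoordRing d) i :=
    coordLift_coord _ _ _
  have hφs : ∀ i, φ (coord p (Fin.castSucc i)) = coord d i := fun i =>
    (hφ _).trans (Fin.snoc_castSucc (α := fun _ => CoordRing d) _ _ i)
  have hφl : φ (coord p (Fin.last n)) = 0 :=
    (hφ _).trans (Fin.snoc_last (α := fun _ => CoordRing d) _ _)
  obtain ⟨T, hT, hA, mk, hmk⟩ : ∃ (T : Type _) (_ : CommRing T) (_ : Algebra F T)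
      (mk : CoordRing p →ₐ[F] T), ∀ x, mk x = 0 ↔ coord p (Fin.last n) ∣ x :=
    ⟨CoordRing p ⧸ Ideal.span {coord p (Fin.last n)}, inferInstance, inferInstance,
      Ideal.Quotient.mkₐ F _, fun x =>
        Ideal.Quotient.eq_zero_iff_mem.trans Ideal.mem_span_singleton⟩
  have hmkl : mk (coord p (Fin.last n)) = 0 := (hmk _).2 (dvd_refl _)
  have hψ0 : evalQF (bc (algebraMap F T) d) (fun i => mk (coord p i.castSucc)) = 0 := by
    have h1 := congrArg mk (evalQF_coord p)
    rw [evalQF_bc_castSucc, map_add, map_mul, map_pow, hmkl, map_zero, zero_pow two_ne_zero,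
      mul_zero, add_zero] at h1
    have h3 := map_evalQF (mk : CoordRing p →+* T) (bc (algebraMap F (CoordRing p)) d)
      (fun i => coord p i.castSucc)
    rw [bc_comp, AlgHom.comp_algebraMap] at h3
    exact h3.symm.trans h1
  let ψ : CoordRing d →ₐ[F] T := coordLift d _ hψ0
  have hψ : ψ.comp φ = mk := by
    refine coordRing_algHom_ext fun i => ?_
    rw [AlgHom.comp_apply]
    refine Fin.lastCases ?_ (fun i => ?_) i
    · rw [hφl, hmkl, map_zero]
    · rw [hφs]
      exact coordLift_coord _ _ hψ0 i
  refine ⟨φ, coord p (Fin.last n), coordRing_surjective φ fun i => ⟨_, hφs i⟩,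
    fun x => ⟨fun hx => ?_, ?_⟩⟩
  · rw [← hmk, ← hψ, AlgHom.comp_apply, hx, map_zero]
  · rintro ⟨y, rfl⟩
    rw [map_mul, hφl, zero_mul]

theorem Isometric.anisotropic {m n : ℕ} {d : Fin m → F} {e : Fin n → F} (h : Isometric d e)
    (hd : Anisotropic d) : Anisotropic e := by
  obtain ⟨φ, hφ⟩ := h.symm
  rintro ⟨v, hv, hv0⟩
  exact hd ⟨φ v, (LinearEquiv.map_ne_zero_iff φ).2 hv, by rw [hφ, hv0]⟩

/-- An isometry over `F`, applied to a vector over an `F`-algebra, preserves values. -/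
theorem evalQF_baseChange (h2 : (2 : F) ≠ 0) {m n : ℕ} {d : Fin m → F} {e : Fin n → F}
    (φ : (Fin m → F) →ₗ[F] (Fin n → F)) (hφ : ∀ v, evalQF e (φ v) = evalQF d v)
    {S : Type*} [CommRing S] [Algebra F S] (x : Fin m → S) :
    evalQF (bc (algebraMap F S) e)
      (fun i => ∑ j, algebraMap F S (φ (Pi.single j 1) i) * x j) =
      evalQF (bc (algebraMap F S) d) x := by
  have hM : ∀ j l, ∑ i, e i * φ (Pi.single j 1) i * φ (Pi.single l 1) i =
      if j = l then d j else 0 := by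
    intro j l
    rw [← bilin_apply, bilin_map_eq h2 φ hφ, bilin_single_left, Pi.single_apply]
    simp
  have hM' : ∀ j l, ∑ i, algebraMap F S (e i) * algebraMap F S (φ (Pi.single j 1) i) *
      algebraMap F S (φ (Pi.single l 1) i) = if j = l then algebraMap F S (d j) else 0 := by
    intro j l
    simpa [apply_ite] using congrArg (algebraMap F S) (hM j l)
  calc _ = ∑ i, ∑ j, ∑ l, (algebraMap F S (e i) * algebraMap F S (φ (Pi.single j 1) i) *
      algebraMap F S (φ (Pi.single l 1) i)) * (x j * x l) := by
        refine Finset.sum_congr rfl fun i _ => ?_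
        rw [sq, Finset.sum_mul_sum, Finset.mul_sum]
        refine Finset.sum_congr rfl fun j _ => ?_
        rw [Finset.mul_sum]
        exact Finset.sum_congr rfl fun l _ => by simp only [bc]; ring
    _ = ∑ j, ∑ l, (∑ i, algebraMap F S (e i) * algebraMap F S (φ (Pi.single j 1) i) *
      algebraMap F S (φ (Pi.single l 1) i)) * (x j * x l) := by
        rw [Finset.sum_comm]
        refine Finset.sum_congr rfl fun j _ => ?_
        rw [Finset.sum_comm]
        simp only [Finset.sum_mul]
    _ = _ := by
        simp only [hM', evalQF, bc]
        exact Finset.sum_congr rfl fun j _ => by simp [sq]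

theorem map_apply_eq_sum {R : Type*} [CommRing R] {m n : ℕ}
    (f : (Fin m → R) →ₗ[R] (Fin n → R)) (v : Fin m → R) (i : Fin n) :
    f v i = ∑ j, f (Pi.single j 1) i * v j := by
  conv_lhs => rw [pi_eq_sum_univ' v]
  simp only [map_sum, map_smul, Finset.sum_apply, Pi.smul_apply, smul_eq_mul]
  exact Finset.sum_congr rfl fun j _ => by rw [mul_comm]

theorem wittIndex_le_of_isometric (h2 : (2 : F) ≠ 0) {m n l : ℕ} {d : Fin m → F} {e : Fin n → F}
    {q : Fin l → F} (h : Isometric d e) (hd : IsDomain (CoordRing d))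
    (he : IsDomain (CoordRing e)) (hq : Nondeg q) :
    WittIndex (bc (algebraMap F (FunField d)) q) ≤
      WittIndex (bc (algebraMap F (FunField e)) q) := by
  obtain ⟨σ, hσ⟩ := h
  have hσ' : ∀ v, evalQF d (σ.symm v) = evalQF e v := fun v => by
    rw [← hσ, LinearEquiv.apply_symm_apply]
  let φ : CoordRing d →ₐ[F] CoordRing e := coordLift d _
    ((evalQF_baseChange h2 (σ.symm : (Fin n → F) →ₗ[F] (Fin m → F)) hσ' (coord e)).trans
      (evalQF_coord e))
  let ψ : CoordRing e →ₐ[F] CoordRing d := coordLift e _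
    ((evalQF_baseChange h2 (σ : (Fin m → F) →ₗ[F] (Fin n → F)) hσ (coord d)).trans
      (evalQF_coord d))
  have hcomp : ∀ {a b : ℕ} {S : Type _} [CommRing S] [Algebra F S]
      (τ : (Fin a → F) ≃ₗ[F] (Fin b → F)) (y : Fin a → S) (i : Fin a),
      ∑ j, algebraMap F S (τ.symm (Pi.single j 1) i) *
        ∑ l, algebraMap F S (τ (Pi.single l 1) j) * y l = y i := by
    intro a b S _ _ τ y i
    have h1 : ∀ l, ∑ j, τ.symm (Pi.single j 1) i * τ (Pi.single l 1) j =
        (Pi.single l 1 : Fin a → F) i := by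
      intro l
      have h3 := map_apply_eq_sum (τ.symm : (Fin b → F) →ₗ[F] (Fin a → F)) (τ (Pi.single l 1)) i
      rw [LinearEquiv.coe_coe, τ.symm_apply_apply] at h3
      exact h3.symm
    calc _ = ∑ l, algebraMap F S (∑ j, τ.symm (Pi.single j 1) i * τ (Pi.single l 1) j) * y l := by
          simp only [Finset.mul_sum, map_sum, map_mul, Finset.sum_mul, mul_assoc]
          exact Finset.sum_comm
      _ = y i := by simp [h1, Pi.single_apply, apply_ite]
  have hψφ : ψ.comp φ = AlgHom.id F _ := coordRing_algHom_ext fun i => by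
    rw [AlgHom.comp_apply, coordLift_coord, map_sum]
    simp only [map_mul, AlgHom.commutes]
    simp only [ψ, coordLift_coord]
    exact hcomp σ (coord d) i
  have hφψ : φ.comp ψ = AlgHom.id F _ := coordRing_algHom_ext fun i => by
    rw [AlgHom.comp_apply, coordLift_coord, map_sum]
    simp only [map_mul, AlgHom.commutes]
    simp only [φ, coordLift_coord]
    exact hcomp σ.symm (coord e) i
  refine wittIndex_le_of_surjective h2 hd he hq φ
    (fun y => ⟨ψ y, DFunLike.congr_fun hφψ y⟩) 0 fun x => ?_
  rw [zero_dvd_iff]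
  refine ⟨fun hx => ?_, fun hx => by rw [hx, map_zero]⟩
  have := DFunLike.congr_fun hψφ x
  rwa [AlgHom.comp_apply, hx, map_zero, eq_comm] at this

theorem nondeg_osum {m n : ℕ} {d : Fin m → F} {e : Fin n → F} (hd : Nondeg d) (he : Nondeg e) :
    Nondeg (osum d e) := by
  intro i
  refine Fin.addCases (fun i => ?_) (fun i => ?_) i
  · simpa [osum] using hd i
  · simpa [osum, -Fin.natAdd_eq_addNat] using he i

theorem Anisotropic.castSucc {n : ℕ} {d : Fin (n + 1) → F} (h : Anisotropic d) :
    Anisotropic (fun i : Fin n => d i.castSucc) := by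
  rintro ⟨v, hv, hv0⟩
  refine h ⟨Fin.snoc v 0, fun h0 => hv ?_, ?_⟩
  · ext i
    simpa using congrFun h0 i.castSucc
  · simpa [evalQF, Fin.sum_univ_castSucc] using hv0

theorem wittIndex_le_castSucc (h2 : (2 : F) ≠ 0) {n l : ℕ} {p : Fin (n + 1) → F} {q : Fin l → F}
    (hn : 2 ≤ n) (hp : Nondeg p) (han : Anisotropic p) (hq : Nondeg q) :
    WittIndex (bc (algebraMap F (FunField p)) q) ≤
      WittIndex (bc (algebraMap F (FunField fun i : Fin n => p i.castSucc)) q) := by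
  obtain ⟨φ, t, hφ, ht⟩ := exists_coordRing_surjection p
  exact wittIndex_le_of_surjective h2 (isDomain_coordRing hp han (by omega))
    (isDomain_coordRing (fun i => hp i.castSucc) han.castSucc hn) hq φ hφ t ht

theorem wittIndex_osum_le (h2 : (2 : F) ≠ 0) {n l : ℕ} {r : Fin n → F} {q : Fin l → F}
    (hr : Nondeg r) (hn : 2 ≤ n) (hq : Nondeg q) :
    ∀ {k : ℕ} (s : Fin k → F), Nondeg s → Anisotropic (osum r s) →
      WittIndex (bc (algebraMap F (FunField (osum r s))) q) ≤
        WittIndex (bc (algebraMap F (FunField r)) q) := by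
  intro k
  induction k with
  | zero =>
    intro s _ _
    have : osum r s = r := by
      ext i
      exact Fin.append_left r s i
    rw [this]
    exact le_rfl
  | succ k ih =>
    intro s hs han
    let s' : Fin k → F := fun i => s i.castSucc
    have hs' : Nondeg s' := fun i => hs i.castSucc
    have hinit : (fun i : Fin (n + k) => osum r s i.castSucc) = osum r s' := by
      ext i
      refine Fin.addCases (fun i => ?_) (fun i => ?_) i
      · exact (Fin.append_left r s i).trans (Fin.append_left r s' i).symm
      · exact (Fin.append_right r s i.castSucc).trans (Fin.append_right r s' i).symm
    have hsub : Anisotropic (osum r s') := by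
      rw [← hinit]
      exact han.castSucc
    have hle := wittIndex_le_castSucc h2 (n := n + k) (p := @osum F n (k + 1) r s) (q := q)
      (by omega) (nondeg_osum hr hs) han hq
    rw [hinit] at hle
    exact hle.trans (ih s' hs' hsub)

end CoordinateRing

end QF

open QF in
/-- Knebusch's specialisation lemma: if `p` is anisotropic over `F` (char `F ≠ 2`) and contains a
subform `r` of dimension at least two, then for any form `q` over `F`,
`i(q_{F(r)}) ≥ i(q_{F(p)})`. -/
theorem stmt_1 {F : Type*} [Field F] (h2 : (2 : F) ≠ 0)
    {np nr nq : ℕ} (p : Fin np → F) (r : Fin nr → F) (q : Fin nq → F)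
    (hp : Nondeg p) (hr : Nondeg r) (hq : Nondeg q) (hq0 : 0 < nq)
    (hpan : Anisotropic p) (hr2 : 2 ≤ nr) (hsub : Subform r p) :
    WittIndex (bc (algebraMap F (FunField p)) q)
      ≤ WittIndex (bc (algebraMap F (FunField r)) q) := by
  obtain ⟨k, s, hs, hiso⟩ := hsub
  have han := hiso.anisotropic hpan
  have hnp : np = nr + k := by
    obtain ⟨φ, -⟩ := hiso
    simpa using φ.finrank_eq
  exact (wittIndex_le_of_isometric h2 hiso (isDomain_coordRing hp hpan (by omega))
    (isDomain_coordRing (nondeg_osum hr hs) han (by omega)) hq).trans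
    (wittIndex_osum_le h2 hr hr2 hq s hs han)
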